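/- arXiv:2305.18415 — 5 statements merged into one kernel-verified Lean document; each statement's English description precedes it below -/
import Mathlib

section
/- In the geometric algebra G_{n,0,r} with r ∈ {0,1}, the grade projection is Pin-equivariant: for every element u of the Pin group Pin(n,0,r), every multivector x, and every grade k, one has u[⟨x⟩_k] = ⟨u[x]⟩_k, where u[·] denotes the sandwich action of u. -/
open CliffordAlgebra

noncomputable section

/-- The quadratic form of the geometric algebra `G_{n,0,r}`: the first `n` coordinates are
orthogonal basis vectors `e_1, …, e_n` of square `+1`, while the remaining `r` coordinates
are degenerate directions of square `0` (when `r = 1`, the last coordinate is `e_0`). -/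
def gaForm (n r : ℕ) : QuadraticForm ℝ (Fin (n + r) → ℝ) :=
  QuadraticMap.weightedSumSquares ℝ (fun i : Fin (n + r) => if (i : ℕ) < n then (1 : ℝ) else 0)

/-- The geometric algebra `G_{n,0,r}`, as a real Clifford algebra. -/
abbrev GA (n r : ℕ) := CliffordAlgebra (gaForm n r)

/-- The `i`-th basis vector of the underlying quadratic space. -/
def gaBasisVec (n r : ℕ) (i : Fin (n + r)) : Fin (n + r) → ℝ := Pi.single i 1

/-- The `i`-th basis vector, embedded in the geometric algebra. -/
def eVec (n r : ℕ) (i : Fin (n + r)) : GA n r := ι (gaForm n r) (gaBasisVec n r i)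

instance : Invertible (2 : ℝ) := invertibleOfNonzero two_ne_zero

/-- The canonical linear equivalence with the exterior algebra (used to transport the
grading and the wedge product to the Clifford algebra). -/
def gaToExt (n r : ℕ) : GA n r ≃ₗ[ℝ] ExteriorAlgebra ℝ (Fin (n + r) → ℝ) :=
  CliffordAlgebra.equivExterior (gaForm n r)

/-- Grade-`k` projection `⟨x⟩_k` of a multivector, setting all non-grade-`k`
components to zero. -/
def gradeProj (n r : ℕ) (k : ℕ) : GA n r →ₗ[ℝ] GA n r :=
  (gaToExt n r).symm.toLinearMap ∘ₗ
    (GradedAlgebra.proj (fun i : ℕ => ⋀[ℝ]^i (Fin (n + r) → ℝ)) k) ∘ₗ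
      (gaToExt n r).toLinearMap

/-- Wedge (exterior) product of multivectors. -/
def wedge (n r : ℕ) (x y : GA n r) : GA n r :=
  (gaToExt n r).symm (gaToExt n r x * gaToExt n r y)

/-- The versor (geometric product of vectors) associated to a list of vectors. -/
def versor (n r : ℕ) (l : List (Fin (n + r) → ℝ)) : GA n r :=
  (l.map (ι (gaForm n r))).prod

/-- `IsUnitVecList n r l` : every vector in the list `l` is an (invertible) unit vector,
so that `versor n r l` is an element of the Pin group. -/
def IsUnitVecList (n r : ℕ) (l : List (Fin (n + r) → ℝ)) : Prop :=
  ∀ v ∈ l, gaForm n r v = 1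

/-- The sandwich action `u[x]` of the Pin-group element `u = v_1 ⋯ v_k` (presented by the
list `l = [v_1, …, v_k]` of unit vectors) on a multivector `x`: `u[x] = u x̂ u⁻¹` if `u` is
odd and `u[x] = u x u⁻¹` if `u` is even, where `x̂` is the grade involution and where
`u⁻¹ = ũ` (the reversal) for a product of unit vectors. -/
def pinAction (n r : ℕ) (l : List (Fin (n + r) → ℝ)) (x : GA n r) : GA n r :=
  versor n r l * ((⇑(involute (Q := gaForm n r)))^[l.length] x) * reverse (versor n r l)

/-- The blade (wedge product) determined by a list of vectors. -/
def bladeList (n r : ℕ) (vs : List (Fin (n + r) → ℝ)) : GA n r :=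
  vs.foldr (fun v acc => wedge n r (ι (gaForm n r) v) acc) 1

/-- `IsBlade n r k x` : `x` is a `k`-blade, i.e. a (scaled) wedge product of `k` vectors. -/
def IsBlade (n r : ℕ) (k : ℕ) (x : GA n r) : Prop :=
  ∃ (c : ℝ) (vs : List (Fin (n + r) → ℝ)), vs.length = k ∧ x = c • bladeList n r vs

/-- Scalar (grade-0) coefficient of a multivector. -/
def scalarCoeff (n r : ℕ) (x : GA n r) : ℝ :=
  ExteriorAlgebra.algebraMapInv (gaToExt n r x)

/-- Squared norm `‖x‖² = ⟨x x̃⟩₀` of a multivector. -/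
def gaNormSq (n r : ℕ) (x : GA n r) : ℝ :=
  scalarCoeff n r (x * reverse x)

/-- Norm `‖x‖ = √⟨x x̃⟩₀` of a multivector. -/
def gaNorm (n r : ℕ) (x : GA n r) : ℝ := Real.sqrt (gaNormSq n r x)

/-- Left contraction `v ⌋ x` of a multivector `x` by a vector `v`, defined gradewise by
`v ⌋ ⟨x⟩_l = ⟨ v ⟨x⟩_l ⟩_{l-1}`. -/
def vContr (n r : ℕ) (v : Fin (n + r) → ℝ) (x : GA n r) : GA n r :=
  ∑ l ∈ Finset.range (n + r + 1),
    gradeProj n r (l - 1) (ι (gaForm n r) v * gradeProj n r l x)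

section Helpers

variable {M : Type*} [AddCommGroup M] [Module ℝ M] {Q : QuadraticForm ℝ M}

/-- The reflection in the hyperplane orthogonal to a unit vector, as an isometry. -/
def reflIsometry (v : M) (hv : Q v = 1) : Q →qᵢ Q where
  toLinearMap := LinearMap.id - (Q.polarBilin v).smulRight v
  map_app' m := by
    have h1 : Q (m + (-(QuadraticMap.polar Q v m)) • v) = Q m := by
      rw [QuadraticMap.map_add (⇑Q), QuadraticMap.map_smul, QuadraticMap.polar_smul_right, hv,
        QuadraticMap.polar_comm Q m v]
      simp only [smul_eq_mul]
      ring
    simpa [sub_eq_add_neg] using h1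

lemma reflIsometry_apply (v : M) (hv : Q v = 1) (m : M) :
    reflIsometry v hv m = m - QuadraticMap.polar Q v m • v := rfl

lemma sandwich_eq_map (v : M) (hv : Q v = 1) (x : CliffordAlgebra Q) :
    ι Q v * involute x * ι Q v = CliffordAlgebra.map (reflIsometry v hv) x := by
  have hvv : ι Q v * ι Q v = 1 := by rw [ι_sq_scalar, hv, map_one]
  induction x using CliffordAlgebra.induction with
  | algebraMap r =>
    rw [AlgHom.commutes, AlgHom.commutes, ← Algebra.commutes, mul_assoc, hvv, mul_one]
  | ι m =>
    rw [involute_ι, map_apply_ι, mul_neg, neg_mul, ι_mul_ι_mul_ι, reflIsometry_apply, hv, one_smul,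
      ← map_neg, neg_sub]
  | mul a b ha hb =>
    rw [map_mul, map_mul, ← ha, ← hb]
    calc ι Q v * (involute a * involute b) * ι Q v
        = ι Q v * involute a * 1 * involute b * ι Q v := by simp only [mul_assoc, one_mul]
      _ = _ := by rw [← hvv]; simp only [mul_assoc]
  | add a b ha hb => rw [map_add, map_add, ← ha, ← hb, mul_add, add_mul]

lemma contractLeft_extMap (f : M →ₗ[ℝ] M) (d : Module.Dual ℝ M) (x : ExteriorAlgebra ℝ M) :
    contractLeft (Q := (0 : QuadraticForm ℝ M)) d (ExteriorAlgebra.map f x) =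
      ExteriorAlgebra.map f (contractLeft (Q := (0 : QuadraticForm ℝ M)) (d ∘ₗ f) x) := by
  induction x using CliffordAlgebra.left_induction with
  | algebraMap r => 
    rw [contractLeft_algebraMap, map_zero]
    erw [AlgHom.commutes]
    exact contractLeft_algebraMap _ _ _
  | add a b ha hb => simp only [map_add, ha, hb]
  | ι_mul x m hx =>
    have h1 : ExteriorAlgebra.map f (ι (0 : QuadraticForm ℝ M) m) = ι (0 : QuadraticForm ℝ M) (f m) :=
      ExteriorAlgebra.map_apply_ι f m
    have h2 (a b : CliffordAlgebra (0 : QuadraticForm ℝ M)) : ExteriorAlgebra.map f (a * b) =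
        ExteriorAlgebra.map f a * ExteriorAlgebra.map f b := map_mul (ExteriorAlgebra.map f) a b
    rw [contractLeft_ι_mul, h2, map_sub, h2, map_smul, h1, ← hx]
    exact contractLeft_ι_mul _ _ _

lemma equivExterior_map (f : Q →qᵢ Q) (x : CliffordAlgebra Q) :
    equivExterior Q (CliffordAlgebra.map f x) =
      ExteriorAlgebra.map f.toLinearMap (equivExterior Q x) := by
  change changeForm changeForm.associated_neg_proof _ =
    ExteriorAlgebra.map f.toLinearMap (changeForm changeForm.associated_neg_proof _)
  induction x using CliffordAlgebra.left_induction with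
  | algebraMap r =>
    rw [AlgHom.commutes, changeForm_algebraMap]
    exact ((ExteriorAlgebra.map f.toLinearMap).commutes r).symm
  | add a b ha hb => simp only [map_add, ha, hb]
  | ι_mul x m hx =>
    have h1 : ExteriorAlgebra.map f.toLinearMap (ι (0 : QuadraticForm ℝ M) m)
        = ι (0 : QuadraticForm ℝ M) (f m) :=
      ExteriorAlgebra.map_apply_ι f.toLinearMap m
    rw [map_mul, map_apply_ι, changeForm_ι_mul, changeForm_ι_mul, hx, map_sub, map_mul, h1]
    refine congrArg₂ _ rfl ?_
    refine (contractLeft_extMap _ _ _).trans ?_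
    congr 2
    congr 1
    ext y
    simp [QuadraticMap.associated_apply, ← map_add]

lemma extMap_mem (f : M →ₗ[ℝ] M) (k : ℕ) (x : ExteriorAlgebra ℝ M) (hx : x ∈ ⋀[ℝ]^k M) :
    ExteriorAlgebra.map f x ∈ ⋀[ℝ]^k M := by
  have h : (⋀[ℝ]^k M).map (ExteriorAlgebra.map f).toLinearMap ≤ ⋀[ℝ]^k M := by
    unfold ExteriorAlgebra.exteriorPower
    rw [Submodule.map_pow]
    refine pow_le_pow_left' ?_ k
    rw [ExteriorAlgebra.ι_range_map_map]
    exact LinearMap.map_le_range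
  exact h ⟨x, hx, rfl⟩

lemma proj_extMap (f : M →ₗ[ℝ] M) (k : ℕ) (x : ExteriorAlgebra ℝ M) :
    GradedAlgebra.proj (fun i : ℕ => ⋀[ℝ]^i M) k (ExteriorAlgebra.map f x) =
      ExteriorAlgebra.map f (GradedAlgebra.proj (fun i : ℕ => ⋀[ℝ]^i M) k x) := by
  induction x using DirectSum.Decomposition.inductionOn fun i : ℕ => ⋀[ℝ]^i M with
  | zero => simp only [map_zero]
  | add a b ha hb => simp only [map_add, ha, hb]
  | @homogeneous i m =>
    obtain ⟨m, hm⟩ := m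
    simp only [GradedAlgebra.proj_apply]
    by_cases h : i = k
    · subst h
      rw [DirectSum.decompose_of_mem_same (fun i : ℕ => ⋀[ℝ]^i M) hm, DirectSum.decompose_of_mem_same (fun i : ℕ => ⋀[ℝ]^i M)
        (extMap_mem f i m hm)]
    · rw [DirectSum.decompose_of_mem_ne (fun i : ℕ => ⋀[ℝ]^i M) hm h, DirectSum.decompose_of_mem_ne (fun i : ℕ => ⋀[ℝ]^i M)
        (extMap_mem f i m hm) h, map_zero]

end Helpers

lemma gradeProj_map (n r k : ℕ) (f : gaForm n r →qᵢ gaForm n r) (x : GA n r) :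
    CliffordAlgebra.map f (gradeProj n r k x) = gradeProj n r k (CliffordAlgebra.map f x) := by
  apply (gaToExt n r).injective
  simp only [gradeProj, LinearMap.comp_apply, LinearEquiv.coe_coe, LinearEquiv.apply_symm_apply]
  have h (y : GA n r) : gaToExt n r (CliffordAlgebra.map f y) =
      ExteriorAlgebra.map f.toLinearMap (gaToExt n r y) := equivExterior_map f y
  rw [h, h, proj_extMap, LinearEquiv.apply_symm_apply]

lemma involute_versor (n r : ℕ) (l : List (Fin (n + r) → ℝ)) :
    involute (versor n r l) = versor n r l ∨ involute (versor n r l) = -versor n r l := by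
  induction l with
  | nil => left; simp [versor]
  | cons v l ih =>
    have h : versor n r (v :: l) = ι (gaForm n r) v * versor n r l := by simp [versor]
    rw [h, map_mul, involute_ι]
    rcases ih with ih | ih <;> rw [ih] <;> simp

lemma pinAction_cons (n r : ℕ) (v : Fin (n + r) → ℝ) (l : List (Fin (n + r) → ℝ)) (x : GA n r) :
    pinAction n r (v :: l) x =
      ι (gaForm n r) v * involute (pinAction n r l x) * ι (gaForm n r) v := by
  have h : versor n r (v :: l) = ι (gaForm n r) v * versor n r l := by simp [versor]
  unfold pinAction
  rw [h, List.length_cons, Function.iterate_succ_apply', reverse.map_mul, reverse_ι, map_mul,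
    map_mul, ← reverse_involute]
  rcases involute_versor n r l with e | e <;> rw [e] <;> simp [mul_assoc]

/-- In `G_{n,0,r}` with `r ∈ {0,1}`, the grade projection is
Pin-equivariant: `u[⟨x⟩_k] = ⟨u[x]⟩_k` for every `u ∈ Pin(n,0,r)` (presented as a product
of unit vectors), every multivector `x` and every grade `k`. -/
theorem grade_projection_pin_equivariant (n r : ℕ) (hr : r = 0 ∨ r = 1)
    (l : List (Fin (n + r) → ℝ)) (hl : IsUnitVecList n r l)
    (x : GA n r) (k : ℕ) :
    pinAction n r l (gradeProj n r k x) = gradeProj n r k (pinAction n r l x) := by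
  induction l with
  | nil => simp [pinAction, versor]
  | cons v l ih =>
    rw [pinAction_cons, pinAction_cons, ih fun w hw => hl w (List.mem_cons_of_mem _ hw),
      sandwich_eq_map v (hl v List.mem_cons_self), sandwich_eq_map v (hl v List.mem_cons_self),
      gradeProj_map]

end
end

section
/- In the projective geometric algebra G_{n,0,1}, the degenerate basis vector e_0 is invariant under the Pin group (u[e_0] = e_0 for every u ∈ Pin(n,0,1)), and consequently the linear map φ(x) = e_0 x (left geometric multiplication by e_0) is Pin(n,0,1)-equivariant: u[φ(x)] = φ(u[x]) for every u ∈ Pin(n,0,1) and every multivector x. -/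
open CliffordAlgebra

noncomputable section

/-- The Euclidean pseudoscalar `e_1 e_2 ⋯ e_n`, the geometric product of the
non-degenerate basis vectors. -/
def eucPseudoscalar (n r : ℕ) : GA n r :=
  (((List.finRange (n + r)).filter (fun i : Fin (n + r) => decide ((i : ℕ) < n))).map
    (eVec n r)).prod

/-- In `G_{n,0,1}`, the degenerate basis vector `e_0` (realized as the last coordinate). -/
def e0 (n : ℕ) : GA n 1 := eVec n 1 (Fin.last n)

/-- A vector of the quadratic space is Euclidean if it has no degenerate (`e_0`) component. -/
def IsEuclideanVec (n r : ℕ) (v : Fin (n + r) → ℝ) : Prop :=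
  ∀ i : Fin (n + r), n ≤ (i : ℕ) → v i = 0

/-- A multivector is Euclidean (contains no `e_0`) if it lies in the subalgebra generated
by the Euclidean vectors. -/
def IsEuclidean (n r : ℕ) (x : GA n r) : Prop :=
  x ∈ Algebra.adjoin ℝ {y : GA n r | ∃ v, IsEuclideanVec n r v ∧ y = ι (gaForm n r) v}

theorem e0_anticomm (n : ℕ) (v : Fin (n + 1) → ℝ) :
    ι (gaForm n 1) v * e0 n = -(e0 n * ι (gaForm n 1) v) := by
  have h : QuadraticMap.polar (gaForm n 1) v (gaBasisVec n 1 (Fin.last n)) = 0 := by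
    unfold QuadraticMap.polar gaForm gaBasisVec
    simp only [QuadraticMap.weightedSumSquares_apply]
    rw [← Finset.sum_sub_distrib, ← Finset.sum_sub_distrib]
    apply Finset.sum_eq_zero
    intro i _
    by_cases hi : (i : ℕ) < n
    · have hne : i ≠ Fin.last n := by
        rintro rfl
        simp at hi
      simp [Pi.single_eq_of_ne hne]
    · simp [hi]
  have h2 := ι_mul_ι_add_swap (Q := gaForm n 1) v (gaBasisVec n 1 (Fin.last n))
  rw [h, map_zero] at h2
  exact eq_neg_of_add_eq_zero_left h2

theorem involute_iter_mul (n k : ℕ) (x y : GA n 1) :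
    ((⇑(involute (Q := gaForm n 1)))^[k] (x * y)) =
      ((⇑(involute (Q := gaForm n 1)))^[k] x) * ((⇑(involute (Q := gaForm n 1)))^[k] y) := by
  induction k generalizing x y with
  | zero => rfl
  | succ k ih => simp only [Function.iterate_succ_apply, map_mul, ih]

theorem involute_iter_neg (n k : ℕ) (x : GA n 1) :
    ((⇑(involute (Q := gaForm n 1)))^[k] (-x)) =
      -((⇑(involute (Q := gaForm n 1)))^[k] x) := by
  induction k generalizing x with
  | zero => rfl
  | succ k ih => simp only [Function.iterate_succ_apply, map_neg, ih]

theorem versor_mul_e0 (n : ℕ) (l : List (Fin (n + 1) → ℝ)) :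
    versor n 1 l * ((⇑(involute (Q := gaForm n 1)))^[l.length] (e0 n)) = e0 n * versor n 1 l := by
  induction l with
  | nil => simp [versor]
  | cons v l ih =>
    have hv : versor n 1 (v :: l) = ι (gaForm n 1) v * versor n 1 l := by simp [versor]
    have he : involute (Q := gaForm n 1) (e0 n) = -e0 n := involute_ι _
    rw [hv, List.length_cons, Function.iterate_succ_apply, he, involute_iter_neg, mul_neg,
      mul_assoc, ih, ← mul_assoc, e0_anticomm, neg_mul, neg_neg, mul_assoc]

theorem versor_mul_reverse (n : ℕ) (l : List (Fin (n + 1) → ℝ)) (hl : IsUnitVecList n 1 l) :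
    versor n 1 l * reverse (versor n 1 l) = 1 := by
  induction l with
  | nil => simp [versor]
  | cons v l ih =>
    have hv : versor n 1 (v :: l) = ι (gaForm n 1) v * versor n 1 l := by simp [versor]
    have h1 : gaForm n 1 v = 1 := hl v (by simp)
    have h2 := ih (fun w hw => hl w (by simp [hw]))
    rw [hv, reverse.map_mul, reverse_ι, mul_assoc, ← mul_assoc (versor n 1 l), h2, one_mul,
      ι_sq_scalar, h1, map_one]

/-- In `G_{n,0,1}`, the degenerate basis vector `e_0` is invariant under
the Pin group, and consequently left geometric multiplication by `e_0` is
`Pin(n,0,1)`-equivariant. -/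
theorem e0_invariant_and_mul_e0_equivariant (n : ℕ)
    (l : List (Fin (n + 1) → ℝ)) (hl : IsUnitVecList n 1 l) :
    pinAction n 1 l (e0 n) = e0 n ∧
      ∀ x : GA n 1, pinAction n 1 l (e0 n * x) = e0 n * pinAction n 1 l x := by
  refine ⟨?_, fun x => ?_⟩
  · rw [pinAction, versor_mul_e0, mul_assoc, versor_mul_reverse n l hl, mul_one]
  · rw [pinAction, pinAction, involute_iter_mul, ← mul_assoc (versor n 1 l), versor_mul_e0]
    simp only [mul_assoc]

end
end

section
/- In the Euclidean (r = 0) or projective (r = 1) geometric algebra G_{n,0,r}, let x be a nonzero k-blade and let u be a 1-versor of unit norm (an invertible vector with u² = 1). Then u[x] = x if and only if u ⌋ x = 0, and u[x] = −x if and only if u ∧ x = 0, where u[·] is the sandwich action, ⌋ is the left contraction, and ∧ is the wedge product. -/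
open CliffordAlgebra

noncomputable section

/-- The covector `v ↦ B(u, v)` with `B` the bilinear form of `gaForm`. -/
def gaDual (n r : ℕ) (u : Fin (n + r) → ℝ) : Module.Dual ℝ (Fin (n + r) → ℝ) :=
  -(QuadraticMap.associated (R := ℝ) (-(gaForm n r)) u)

theorem gaDual_two (n r : ℕ) (u v : Fin (n + r) → ℝ) :
    2 * gaDual n r u v = QuadraticMap.polar (gaForm n r) u v := by
  have h := QuadraticMap.two_nsmul_associated ℝ (-(gaForm n r))
  have h2 := congrArg (fun B => B u v) h
  simp only [LinearMap.smul_apply, QuadraticMap.polarBilin_apply_apply, nsmul_eq_mul,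
    FunLike.coe_neg, QuadraticMap.polar_neg] at h2
  simp only [gaDual, LinearMap.neg_apply]
  push_cast at h2
  linarith

theorem ga_commutator (n r : ℕ) (u : Fin (n + r) → ℝ) (x : GA n r) :
    ι (gaForm n r) u * x - involute x * ι (gaForm n r) u
      = (2 : ℝ) • contractLeft (gaDual n r u) x := by
  induction x using CliffordAlgebra.left_induction with
  | algebraMap c => simp [Algebra.commutes]
  | add x y hx hy =>
    rw [map_add, map_add, smul_add, ← hx, ← hy]
    noncomm_ring
  | ι_mul x m hx =>
    rw [contractLeft_ι_mul, smul_sub, smul_smul, gaDual_two, ← mul_smul_comm, ← hx, map_mul,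
      involute_ι, ← mul_assoc, ι_mul_ι_comm, Algebra.smul_def]
    noncomm_ring

theorem gaToExt_ι (n r : ℕ) (u : Fin (n + r) → ℝ) :
    gaToExt n r (ι (gaForm n r) u) = ExteriorAlgebra.ι ℝ u :=
  changeForm_ι changeForm.associated_neg_proof _

theorem gaToExt_one (n r : ℕ) : gaToExt n r 1 = 1 :=
  changeForm_one changeForm.associated_neg_proof

theorem gaToExt_contract (n r : ℕ) (d : Module.Dual ℝ (Fin (n + r) → ℝ)) (x : GA n r) :
    gaToExt n r (contractLeft d x)
      = contractLeft (Q := (0 : QuadraticForm ℝ (Fin (n + r) → ℝ))) d (gaToExt n r x) :=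
  changeForm_contractLeft changeForm.associated_neg_proof _ _

theorem gaToExt_ι_mul (n r : ℕ) (u : Fin (n + r) → ℝ) (x : GA n r) :
    gaToExt n r (ι (gaForm n r) u * x)
      = ExteriorAlgebra.ι ℝ u * gaToExt n r x + gaToExt n r (contractLeft (gaDual n r u) x) := by
  rw [gaToExt_contract, gaDual, map_neg, LinearMap.neg_apply, ← sub_eq_add_neg]
  exact changeForm_ι_mul changeForm.associated_neg_proof _ _

theorem wedge_ι (n r : ℕ) (u : Fin (n + r) → ℝ) (x : GA n r) :
    wedge n r (ι (gaForm n r) u) x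
      = ι (gaForm n r) u * x - contractLeft (gaDual n r u) x := by
  rw [wedge, LinearEquiv.symm_apply_eq, map_sub, gaToExt_ι_mul, gaToExt_ι, add_sub_cancel_right]

theorem gaToExt_bladeList (n r : ℕ) (vs : List (Fin (n + r) → ℝ)) :
    gaToExt n r (bladeList n r vs) = (vs.map (ExteriorAlgebra.ι ℝ)).prod := by
  induction vs with
  | nil => exact gaToExt_one n r
  | cons v vs ih =>
    rw [List.map_cons, List.prod_cons, ← ih, ← gaToExt_ι]
    exact (gaToExt n r).apply_symm_apply _

theorem ext_ι_mul_mem {V : Type*} [AddCommGroup V] [Module ℝ V] (v : V) (k : ℕ)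
    {y : ExteriorAlgebra ℝ V} (hy : y ∈ ⋀[ℝ]^k V) :
    ExteriorAlgebra.ι ℝ v * y ∈ ⋀[ℝ]^(k + 1) V := by
  unfold ExteriorAlgebra.exteriorPower at hy ⊢
  rw [pow_succ']
  exact Submodule.mul_mem_mul (LinearMap.mem_range_self _ _) hy

theorem ext_prod_mem {V : Type*} [AddCommGroup V] [Module ℝ V] (vs : List V) :
    (vs.map (ExteriorAlgebra.ι ℝ)).prod ∈ ⋀[ℝ]^vs.length V := by
  induction vs with
  | nil => simp [ExteriorAlgebra.exteriorPower]
  | cons v vs ih => exact ext_ι_mul_mem v _ ih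

theorem ext_contract_mem {V : Type*} [AddCommGroup V] [Module ℝ V] (d : Module.Dual ℝ V)
    (vs : List V) :
    contractLeft (Q := (0 : QuadraticForm ℝ V)) d (vs.map (ExteriorAlgebra.ι ℝ)).prod
      ∈ ⋀[ℝ]^(vs.length - 1) V := by
  induction vs with
  | nil =>
    rw [List.map_nil, List.prod_nil]
    erw [contractLeft_one]
    exact Submodule.zero_mem _
  | cons v vs ih =>
    have h := contractLeft_ι_mul (Q := (0 : QuadraticForm ℝ V)) d v
      (vs.map (ExteriorAlgebra.ι ℝ)).prod
    rw [List.map_cons, List.prod_cons]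
    erw [h]
    refine Submodule.sub_mem _ (Submodule.smul_mem _ _ (ext_prod_mem vs)) ?_
    cases vs with
    | nil =>
      rw [List.map_nil, List.prod_nil]
      erw [contractLeft_one, mul_zero]
      exact Submodule.zero_mem _
    | cons w vs => exact ext_ι_mul_mem v _ ih

theorem ext_prod_zero {m : ℕ} (vs : List (Fin m → ℝ)) (h : m < vs.length) :
    (vs.map (ExteriorAlgebra.ι ℝ)).prod = 0 := by
  have h1 : (vs.map (ExteriorAlgebra.ι ℝ)).prod
      = ExteriorAlgebra.ιMulti ℝ vs.length (fun i => vs.get i) := by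
    rw [ExteriorAlgebra.ιMulti_apply]
    congr 1
    conv_lhs => rw [← List.ofFn_get vs, List.map_ofFn]
    rfl
  rw [h1]
  apply AlternatingMap.map_linearDependent
  intro hli
  have := hli.fintype_card_le_finrank
  simp at this
  omega

theorem gradeProj_same (n r k : ℕ) (x : GA n r)
    (h : gaToExt n r x ∈ ⋀[ℝ]^k (Fin (n + r) → ℝ)) : gradeProj n r k x = x := by
  have := DirectSum.decompose_of_mem_same (fun i : ℕ => ⋀[ℝ]^i (Fin (n + r) → ℝ)) h
  refine (LinearEquiv.symm_apply_eq _).2 ?_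
  exact this

theorem gradeProj_ne (n r k l : ℕ) (x : GA n r)
    (h : gaToExt n r x ∈ ⋀[ℝ]^k (Fin (n + r) → ℝ)) (hkl : k ≠ l) : gradeProj n r l x = 0 := by
  have := DirectSum.decompose_of_mem_ne (fun i : ℕ => ⋀[ℝ]^i (Fin (n + r) → ℝ)) h hkl
  refine (LinearEquiv.symm_apply_eq _).2 ?_
  rw [map_zero]
  exact this

theorem vContr_blade (n r k : ℕ) (x : GA n r) (hx : IsBlade n r k x) (hx0 : x ≠ 0)
    (u : Fin (n + r) → ℝ) : vContr n r u x = contractLeft (gaDual n r u) x := by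
  obtain ⟨c, vs, rfl, rfl⟩ := hx
  set b := bladeList n r vs with hb
  have hbm : gaToExt n r (c • b) ∈ ⋀[ℝ]^vs.length (Fin (n + r) → ℝ) := by
    rw [map_smul, hb, gaToExt_bladeList]
    exact Submodule.smul_mem _ _ (ext_prod_mem vs)
  have hcm : gaToExt n r (contractLeft (gaDual n r u) (c • b))
      ∈ ⋀[ℝ]^(vs.length - 1) (Fin (n + r) → ℝ) := by
    rw [map_smul, map_smul, gaToExt_contract, hb, gaToExt_bladeList]
    exact Submodule.smul_mem _ _ (ext_contract_mem _ vs)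
  have hk : vs.length ≤ n + r := by
    by_contra hk
    apply hx0
    apply (gaToExt n r).injective
    rw [map_smul, hb, gaToExt_bladeList, ext_prod_zero vs (by omega), smul_zero, map_zero]
  have hw : gaToExt n r (wedge n r (ι (gaForm n r) u) (c • b))
      ∈ ⋀[ℝ]^(vs.length + 1) (Fin (n + r) → ℝ) := by
    rw [wedge, LinearEquiv.apply_symm_apply, gaToExt_ι]
    exact ext_ι_mul_mem _ _ hbm
  unfold vContr
  rw [Finset.sum_eq_single vs.length]
  · rw [gradeProj_same _ _ _ _ hbm]
    have e : ι (gaForm n r) u * (c • b)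
        = wedge n r (ι (gaForm n r) u) (c • b) + contractLeft (gaDual n r u) (c • b) := by
      rw [wedge_ι, sub_add_cancel]
    rw [e, map_add, gradeProj_ne _ _ _ _ _ hw (by omega), gradeProj_same _ _ _ _ hcm, zero_add]
  · intro l _ hl
    rw [gradeProj_ne _ _ _ _ _ hbm hl.symm, mul_zero, map_zero]
  · intro h
    simp at h
    omega

/-- In `G_{n,0,r}` (`r ∈ {0,1}`), for a nonzero `k`-blade `x` and a unit
1-versor `u` (an invertible vector with `u² = 1`): `u[x] = x ↔ u ⌋ x = 0` and
`u[x] = −x ↔ u ∧ x = 0`. -/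
theorem blade_invariant_antiinvariant (n r k : ℕ) (hr : r = 0 ∨ r = 1)
    (x : GA n r) (hx : IsBlade n r k x) (hx0 : x ≠ 0)
    (u : Fin (n + r) → ℝ) (hu : gaForm n r u = 1) :
    (pinAction n r [u] x = x ↔ vContr n r u x = 0) ∧
      (pinAction n r [u] x = -x ↔ wedge n r (ι (gaForm n r) u) x = 0) := by
  have hA : pinAction n r [u] x = ι (gaForm n r) u * involute x * ι (gaForm n r) u := by
    simp [pinAction, versor]
  have hsq : ι (gaForm n r) u * ι (gaForm n r) u = 1 := by
    rw [ι_sq_scalar, hu, map_one]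
  have hc := ga_commutator n r u x
  have key : ∀ y : GA n r, ι (gaForm n r) u * involute x * ι (gaForm n r) u = y ↔
      involute x * ι (gaForm n r) u = ι (gaForm n r) u * y := by
    intro y
    constructor
    · rintro rfl
      rw [mul_assoc, ← mul_assoc (ι (gaForm n r) u), hsq, one_mul]
    · intro h
      rw [mul_assoc, h, ← mul_assoc, hsq, one_mul]
  rw [vContr_blade n r k x hx hx0, wedge_ι, hA, key, key]
  constructor
  · rw [eq_comm, ← sub_eq_zero, hc, smul_eq_zero_iff_right two_ne_zero]
  · have h2 : (2 : ℝ) • (ι (gaForm n r) u * x - contractLeft (gaDual n r u) x)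
        = involute x * ι (gaForm n r) u + ι (gaForm n r) u * x := by
      rw [smul_sub, ← hc, two_smul]
      abel
    rw [mul_neg, eq_neg_iff_add_eq_zero, ← h2, smul_eq_zero_iff_right two_ne_zero]

end
end

section
/- For the n-dimensional Euclidean geometric algebra G_{n,0,0}, every linear endomorphism φ: G_{n,0,0} → G_{n,0,0} that is equivariant to the sandwich action of the group Pin(n,0,0) is of the form φ(x) = Σ_{k=0}^{n} w_k ⟨x⟩_k for some parameters w ∈ ℝ^{n+1}, where ⟨x⟩_k is the grade-k projection. -/
open CliffordAlgebra

noncomputable section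

section Helpers

/-- Product of basis vectors along a list. -/
def eL (n : ℕ) (l : List (Fin (n + 0))) : GA n 0 := (l.map (eVec n 0)).prod

theorem eL_nil (n : ℕ) : eL n [] = 1 := by simp [eL]

theorem eL_cons (n : ℕ) (i : Fin (n + 0)) (l : List (Fin (n + 0))) :
    eL n (i :: l) = eVec n 0 i * eL n l := by simp [eL]

theorem gaForm_apply (n : ℕ) (v : Fin (n + 0) → ℝ) : gaForm n 0 v = ∑ i, v i * v i := by
  have h : ∀ i : Fin (n + 0), (i : ℕ) < n := fun i => i.2
  simp [gaForm, QuadraticMap.weightedSumSquares_apply, h]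

theorem gaForm_polar (n : ℕ) (v w : Fin (n + 0) → ℝ) :
    QuadraticMap.polar (gaForm n 0) v w = 2 * ∑ i, v i * w i := by
  simp only [QuadraticMap.polar, gaForm_apply, Finset.mul_sum, ← Finset.sum_sub_distrib]
  apply Finset.sum_congr rfl
  intro i _
  simp only [Pi.add_apply]
  ring

theorem gaForm_basis (n : ℕ) (i : Fin (n + 0)) : gaForm n 0 (gaBasisVec n 0 i) = 1 := by
  rw [gaForm_apply, Finset.sum_eq_single i]
  · simp [gaBasisVec]
  · intro b _ hb
    simp [gaBasisVec, hb]
  · simp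

theorem polar_basis (n : ℕ) (v : Fin (n + 0) → ℝ) (i : Fin (n + 0)) :
    QuadraticMap.polar (gaForm n 0) v (gaBasisVec n 0 i) = 2 * v i := by
  rw [gaForm_polar, Finset.sum_eq_single i]
  · simp [gaBasisVec]
  · intro b _ hb
    simp [gaBasisVec, hb]
  · simp

theorem eVec_sq (n : ℕ) (i : Fin (n + 0)) : eVec n 0 i * eVec n 0 i = 1 := by
  rw [eVec, ι_sq_scalar, gaForm_basis, map_one]

theorem basis_ortho (n : ℕ) {i j : Fin (n + 0)} (h : i ≠ j) :
    QuadraticMap.polar (gaForm n 0) (gaBasisVec n 0 i) (gaBasisVec n 0 j) = 0 := by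
  rw [polar_basis]
  simp [gaBasisVec, h.symm]

theorem eVec_anti (n : ℕ) {i j : Fin (n + 0)} (h : i ≠ j) :
    eVec n 0 i * eVec n 0 j = - (eVec n 0 j * eVec n 0 i) := by
  have := ι_mul_ι_add_swap (Q := gaForm n 0) (gaBasisVec n 0 i) (gaBasisVec n 0 j)
  rw [basis_ortho n h, map_zero] at this
  exact eq_neg_of_add_eq_zero_left this

/-- The action of one unit vector. -/
def rho (n : ℕ) (v : Fin (n + 0) → ℝ) : GA n 0 →ₗ[ℝ] GA n 0 :=
  LinearMap.mulRight ℝ (ι (gaForm n 0) v) ∘ₗ LinearMap.mulLeft ℝ (ι (gaForm n 0) v) ∘ₗ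
    (involute (Q := gaForm n 0)).toLinearMap

theorem rho_apply (n : ℕ) (v : Fin (n + 0) → ℝ) (x : GA n 0) :
    rho n v x = ι (gaForm n 0) v * involute x * ι (gaForm n 0) v := rfl

theorem pinAction_single (n : ℕ) (v : Fin (n + 0) → ℝ) (x : GA n 0) :
    pinAction n 0 [v] x = rho n v x := by
  simp [pinAction, versor, rho_apply]

theorem rho_one (n : ℕ) (v : Fin (n + 0) → ℝ) (hv : gaForm n 0 v = 1) :
    rho n v 1 = 1 := by
  rw [rho_apply, map_one, mul_one, ι_sq_scalar, hv, map_one]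

theorem rho_mul (n : ℕ) (v : Fin (n + 0) → ℝ) (hv : gaForm n 0 v = 1) (x y : GA n 0) :
    rho n v (x * y) = rho n v x * rho n v y := by
  have h : ι (gaForm n 0) v * ι (gaForm n 0) v = 1 := by rw [ι_sq_scalar, hv, map_one]
  simp only [rho_apply, map_mul]
  calc _ = ι (gaForm n 0) v * involute x * 1 * involute y * ι (gaForm n 0) v := by
        simp only [mul_one, mul_assoc]
    _ = _ := by rw [← h]; simp only [mul_assoc]

theorem rho_eVec (n : ℕ) (v : Fin (n + 0) → ℝ) (hv : gaForm n 0 v = 1) (i : Fin (n + 0)) :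
    rho n v (eVec n 0 i) = ι (gaForm n 0) (gaBasisVec n 0 i - (2 * v i) • v) := by
  rw [rho_apply, eVec, involute_ι, mul_neg, neg_mul, ι_mul_ι_mul_ι, hv, polar_basis, ← map_neg]
  congr 1
  simp

theorem rho_basis_self (n : ℕ) (i : Fin (n + 0)) :
    rho n (gaBasisVec n 0 i) (eVec n 0 i) = - eVec n 0 i := by
  rw [rho_eVec n _ (gaForm_basis n i), eVec, ← map_neg]
  congr 1
  simp [gaBasisVec, two_smul]

theorem rho_basis_ne (n : ℕ) {i j : Fin (n + 0)} (h : j ≠ i) :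
    rho n (gaBasisVec n 0 i) (eVec n 0 j) = eVec n 0 j := by
  rw [rho_eVec n _ (gaForm_basis n i), eVec]
  congr 1
  simp [gaBasisVec, h]

theorem rho_eL_not_mem (n : ℕ) (i : Fin (n + 0)) (l : List (Fin (n + 0))) (h : i ∉ l) :
    rho n (gaBasisVec n 0 i) (eL n l) = eL n l := by
  induction l with
  | nil => rw [eL_nil, rho_one n _ (gaForm_basis n i)]
  | cons a l ih =>
    simp only [List.mem_cons, not_or] at h
    rw [eL_cons, rho_mul n _ (gaForm_basis n i), ih h.2, rho_basis_ne n (Ne.symm h.1)]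

theorem rho_eL_mem (n : ℕ) (i : Fin (n + 0)) (l : List (Fin (n + 0))) (hl : l.Nodup)
    (h : i ∈ l) : rho n (gaBasisVec n 0 i) (eL n l) = - eL n l := by
  induction l with
  | nil => simp at h
  | cons a l ih =>
    rw [List.nodup_cons] at hl
    rw [eL_cons, rho_mul n _ (gaForm_basis n i)]
    by_cases hia : i = a
    · subst hia
      rw [rho_basis_self, rho_eL_not_mem n _ _ hl.1, neg_mul]
    · have : i ∈ l := by simpa [hia] using h
      rw [rho_basis_ne n (Ne.symm hia), ih hl.2 this, mul_neg]

/-- The unit normal swapping two basis vectors. -/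
def swapVec (n : ℕ) (i j : Fin (n + 0)) : Fin (n + 0) → ℝ :=
  (Real.sqrt 2)⁻¹ • (gaBasisVec n 0 i - gaBasisVec n 0 j)

theorem gaForm_swapVec (n : ℕ) {i j : Fin (n + 0)} (h : i ≠ j) :
    gaForm n 0 (swapVec n i j) = 1 := by
  have h1 := QuadraticMap.map_add (gaForm n 0) (gaBasisVec n 0 i) (-gaBasisVec n 0 j)
  rw [QuadraticMap.polar_neg_right, basis_ortho n h, QuadraticMap.map_neg, gaForm_basis,
    gaForm_basis] at h1
  rw [swapVec, QuadraticMap.map_smul, sub_eq_add_neg, h1, ← mul_inv,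
    Real.mul_self_sqrt (by norm_num)]
  norm_num

theorem rho_swap_eVec (n : ℕ) {i j : Fin (n + 0)} (h : i ≠ j) (k : Fin (n + 0)) :
    rho n (swapVec n i j) (eVec n 0 k) = eVec n 0 (Equiv.swap i j k) := by
  rw [rho_eVec n _ (gaForm_swapVec n h), eVec]
  congr 1
  ext m
  have h2 : (Real.sqrt 2)⁻¹ * (Real.sqrt 2)⁻¹ = 1 / 2 := by
    rw [← mul_inv, Real.mul_self_sqrt (by norm_num)]; norm_num
  have key : ∀ a b : ℝ, 2 * ((Real.sqrt 2)⁻¹ * a) * ((Real.sqrt 2)⁻¹ * b) = a * b := by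
    intro a b
    linear_combination (2 * a * b) * h2
  simp only [swapVec, Pi.sub_apply, Pi.smul_apply, smul_eq_mul, key]
  simp only [gaBasisVec, Pi.single_apply]
  rw [Equiv.swap_apply_def]
  by_cases hki : k = i
  · subst hki
    by_cases hm : m = k
    · subst hm; simp [h]
    · simp [hm, h]
  · by_cases hkj : k = j
    · subst hkj
      simp [hki]
    · simp [hki, hkj]

theorem rho_swap_eL (n : ℕ) {i j : Fin (n + 0)} (h : i ≠ j) (l : List (Fin (n + 0))) :
    rho n (swapVec n i j) (eL n l) = eL n (l.map (Equiv.swap i j)) := by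
  induction l with
  | nil => rw [List.map_nil, eL_nil, rho_one n _ (gaForm_swapVec n h)]
  | cons a l ih =>
    rw [List.map_cons, eL_cons, eL_cons, rho_mul n _ (gaForm_swapVec n h), ih,
      rho_swap_eVec n h]

theorem eL_ne_zero (n : ℕ) (l : List (Fin (n + 0))) : eL n l ≠ 0 := by
  have : IsUnit (eL n l) := by
    induction l with
    | nil => rw [eL_nil]; exact isUnit_one
    | cons a l ih =>
      rw [eL_cons]
      exact (Units.mk _ _ (eVec_sq n a) (eVec_sq n a)).isUnit.mul ih
  exact this.ne_zero

theorem eL_perm (n : ℕ) {l l' : List (Fin (n + 0))} (h : l.Perm l') (hl : l.Nodup) :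
    eL n l' = eL n l ∨ eL n l' = - eL n l := by
  induction h with
  | nil => simp
  | cons x h ih =>
    rcases ih (List.nodup_cons.1 hl).2 with h | h <;> simp [eL_cons, h]
  | swap x y l =>
    right
    have : y ≠ x := by
      intro h; subst h; simp at hl
    rw [eL_cons, eL_cons, eL_cons, eL_cons, ← mul_assoc, eVec_anti n this.symm, neg_mul, mul_assoc]
  | trans h1 h2 ih1 ih2 =>
    rcases ih1 hl with h | h <;> rcases ih2 (h1.nodup_iff.1 hl) with h' | h' <;> simp [h, h']

theorem eL_mul_mem (n : ℕ) (i : Fin (n + 0)) (l : List (Fin (n + 0))) (hl : l.Nodup) :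
    eVec n 0 i * eL n l ∈ Submodule.span ℝ {x | ∃ l : List (Fin (n + 0)), l.Nodup ∧ x = eL n l} := by
  by_cases h : i ∈ l
  · have hp := List.perm_cons_erase h
    have he : (l.erase i).Nodup := hl.erase i
    have hm : eL n (l.erase i) ∈
        Submodule.span ℝ {x | ∃ l : List (Fin (n + 0)), l.Nodup ∧ x = eL n l} :=
      Submodule.subset_span ⟨_, he, rfl⟩
    rcases eL_perm n hp.symm (hp.nodup_iff.1 hl) with h1 | h1
    · rw [h1, eL_cons, ← mul_assoc, eVec_sq, one_mul]; exact hm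
    · rw [h1, eL_cons, mul_neg, ← mul_assoc, eVec_sq, one_mul]; exact neg_mem hm
  · rw [← eL_cons]
    exact Submodule.subset_span ⟨_, List.nodup_cons.2 ⟨h, hl⟩, rfl⟩

theorem eL_span (n : ℕ) (x : GA n 0) :
    x ∈ Submodule.span ℝ {x | ∃ l : List (Fin (n + 0)), l.Nodup ∧ x = eL n l} := by
  induction x using CliffordAlgebra.left_induction with
  | algebraMap r =>
    rw [Algebra.algebraMap_eq_smul_one]
    exact Submodule.smul_mem _ _ (Submodule.subset_span ⟨[], List.nodup_nil, (eL_nil n).symm⟩)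
  | add x y hx hy => exact add_mem hx hy
  | ι_mul x m hx =>
    have hm : m = ∑ i, m i • gaBasisVec n 0 i := by
      ext j
      simp [gaBasisVec, Finset.sum_apply, Pi.single_apply]
    have h1 : ∀ i, eVec n 0 i * x ∈
        Submodule.span ℝ {x | ∃ l : List (Fin (n + 0)), l.Nodup ∧ x = eL n l} := by
      intro i
      induction hx using Submodule.span_induction with
      | mem x h => obtain ⟨l, hl, rfl⟩ := h; exact eL_mul_mem n i l hl
      | zero => rw [mul_zero]; exact zero_mem _
      | add x y _ _ hx hy => rw [mul_add]; exact add_mem hx hy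
      | smul a x _ hx => rw [mul_smul_comm]; exact Submodule.smul_mem _ _ hx
    rw [hm, map_sum, Finset.sum_mul]
    refine sum_mem fun i _ => ?_
    rw [map_smul, smul_mul_assoc]
    exact Submodule.smul_mem _ _ (h1 i)

theorem contract_eL (n : ℕ) (d : Module.Dual ℝ (Fin (n + 0) → ℝ)) (l : List (Fin (n + 0)))
    (h : ∀ j ∈ l, d (gaBasisVec n 0 j) = 0) :
    contractLeft d ((l.map fun i => ExteriorAlgebra.ι ℝ (gaBasisVec n 0 i)).prod :
      ExteriorAlgebra ℝ (Fin (n + 0) → ℝ)) = 0 := by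
  induction l with
  | nil => simp
  | cons a l ih =>
    rw [List.map_cons, List.prod_cons]
    refine (contractLeft_ι_mul _ _ _).trans ?_
    rw [ih fun j hj => h j (List.mem_cons_of_mem _ hj), h a List.mem_cons_self]
    simp

theorem gaToExt_eL (n : ℕ) (l : List (Fin (n + 0))) (hl : l.Nodup) :
    gaToExt n 0 (eL n l) = (l.map fun i => ExteriorAlgebra.ι ℝ (gaBasisVec n 0 i)).prod := by
  induction l with
  | nil => rw [eL_nil]; exact changeForm_one changeForm.associated_neg_proof
  | cons a l ih =>
    rw [List.nodup_cons] at hl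
    rw [eL_cons, List.map_cons, List.prod_cons]
    refine (changeForm_ι_mul changeForm.associated_neg_proof _ _).trans ?_
    have ih' := ih hl.2
    change changeForm changeForm.associated_neg_proof (eL n l) = _ at ih'
    rw [ih', contract_eL n _ l, sub_zero]
    · intro j hj
      have : a ≠ j := by rintro rfl; exact hl.1 hj
      have h0 := basis_ortho n this
      rw [QuadraticMap.associated_apply]
      have h1 := h0
      simp only [QuadraticMap.polar] at h1
      simp only [QuadraticMap.neg_apply]
      rw [show -(gaForm n 0) (gaBasisVec n 0 a + gaBasisVec n 0 j)
          - -(gaForm n 0) (gaBasisVec n 0 a) - -(gaForm n 0) (gaBasisVec n 0 j) = 0 by linarith]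
      simp

theorem gradeProj_eL (n : ℕ) (l : List (Fin (n + 0))) (hl : l.Nodup) (k : ℕ) :
    gradeProj n 0 k (eL n l) = if l.length = k then eL n l else 0 := by
  have hmem : gaToExt n 0 (eL n l) ∈ ⋀[ℝ]^(l.length) (Fin (n + 0) → ℝ) := by
    rw [gaToExt_eL n l hl]
    have := SetLike.list_prod_map_mem_graded (A := fun i : ℕ => ⋀[ℝ]^i (Fin (n + 0) → ℝ)) l
      (fun _ => 1) (fun i => ExteriorAlgebra.ι ℝ (gaBasisVec n 0 i)) (by
        intro j _
        rw [ExteriorAlgebra.exteriorPower, pow_one]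
        exact LinearMap.mem_range_self _ _)
    simpa using this
  simp only [gradeProj, LinearMap.comp_apply, LinearEquiv.coe_coe, GradedAlgebra.proj_apply]
  split_ifs with h
  · subst h
    rw [DirectSum.decompose_of_mem_same (fun i : ℕ => ⋀[ℝ]^i (Fin (n + 0) → ℝ)) hmem,
      LinearEquiv.symm_apply_apply]
  · rw [DirectSum.decompose_of_mem_ne (fun i : ℕ => ⋀[ℝ]^i (Fin (n + 0) → ℝ)) hmem h, map_zero]

theorem eigen_span (n : ℕ) (l : List (Fin (n + 0))) (y : GA n 0)
    (h1 : ∀ i ∈ l, rho n (gaBasisVec n 0 i) y = - y)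
    (h2 : ∀ i, i ∉ l → rho n (gaBasisVec n 0 i) y = y) (L : List (Fin (n + 0))) :
    y ∈ Submodule.span ℝ {x | ∃ l' : List (Fin (n + 0)), l'.Nodup ∧
      (∀ i ∈ L, (i ∈ l' ↔ i ∈ l)) ∧ x = eL n l'} := by
  induction L with
  | nil => simpa using eL_span n y
  | cons i L ih =>
    obtain ⟨s, hs, hy⟩ : ∃ s : ℝ, (∀ l' : List (Fin (n + 0)), l'.Nodup →
        rho n (gaBasisVec n 0 i) (eL n l') = (if (i ∈ l' ↔ i ∈ l) then s else -s) • eL n l') ∧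
        s * s = 1 ∧ rho n (gaBasisVec n 0 i) y = s • y := by
      by_cases h : i ∈ l
      · refine ⟨-1, fun l' hl' => ?_, by norm_num, by simp [h1 i h]⟩
        by_cases h' : i ∈ l'
        · simp [h, h', rho_eL_mem n i l' hl' h']
        · simp [h, h', rho_eL_not_mem n i l' h']
      · refine ⟨1, fun l' hl' => ?_, by norm_num, by simp [h2 i h]⟩
        by_cases h' : i ∈ l'
        · simp [h, h', rho_eL_mem n i l' hl' h']
        · simp [h, h', rho_eL_not_mem n i l' h']
    obtain ⟨hss, hy⟩ := hy
    have key : ∀ z ∈ Submodule.span ℝ {x | ∃ l' : List (Fin (n + 0)), l'.Nodup ∧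
        (∀ i ∈ L, (i ∈ l' ↔ i ∈ l)) ∧ x = eL n l'},
        z + s • rho n (gaBasisVec n 0 i) z ∈ Submodule.span ℝ
          {x | ∃ l' : List (Fin (n + 0)), l'.Nodup ∧
            (∀ j ∈ i :: L, (j ∈ l' ↔ j ∈ l)) ∧ x = eL n l'} := by
      intro z hz
      induction hz using Submodule.span_induction with
      | mem x h =>
        obtain ⟨l', hl', hL, rfl⟩ := h
        rw [hs l' hl', smul_smul]
        split_ifs with hi
        · rw [hss, one_smul]
          have : eL n l' ∈ Submodule.span ℝ
              {x | ∃ l' : List (Fin (n + 0)), l'.Nodup ∧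
                (∀ j ∈ i :: L, (j ∈ l' ↔ j ∈ l)) ∧ x = eL n l'} := by
            refine Submodule.subset_span ⟨l', hl', ?_, rfl⟩
            intro j hj
            rcases List.mem_cons.1 hj with rfl | hj
            · exact hi
            · exact hL j hj
          exact add_mem this this
        · rw [mul_neg, hss, neg_smul, one_smul, add_neg_cancel]
          exact zero_mem _
      | zero => simp
      | add x y _ _ hx hy =>
        rw [map_add, smul_add, add_add_add_comm]; exact add_mem hx hy
      | smul a x _ hx =>
        rw [map_smul, smul_comm s a, ← smul_add]; exact Submodule.smul_mem _ _ hx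
    have h3 := key y ih
    rw [hy, smul_smul, hss, one_smul, ← two_smul ℝ y] at h3
    have h4 := Submodule.smul_mem _ (2⁻¹ : ℝ) h3
    rwa [smul_smul, inv_mul_cancel₀ two_ne_zero, one_smul] at h4

theorem eigen_eq (n : ℕ) (l : List (Fin (n + 0))) (hl : l.Nodup) (y : GA n 0)
    (h1 : ∀ i ∈ l, rho n (gaBasisVec n 0 i) y = - y)
    (h2 : ∀ i, i ∉ l → rho n (gaBasisVec n 0 i) y = y) : ∃ c : ℝ, y = c • eL n l := by
  have h := eigen_span n l y h1 h2 (List.finRange (n + 0))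
  have h' : y ∈ Submodule.span ℝ {eL n l} := by
    refine Submodule.span_le.2 ?_ h
    rintro _ ⟨l', hl', hL, rfl⟩
    have hp : l.Perm l' := (List.perm_ext_iff_of_nodup hl hl').2
      fun i => (hL i (List.mem_finRange i)).symm
    have hm := Submodule.mem_span_singleton_self (R := ℝ) (eL n l)
    rcases eL_perm n hp hl with h | h
    · rw [h]; exact hm
    · rw [h]; exact neg_mem hm
  obtain ⟨c, hc⟩ := Submodule.mem_span_singleton.1 h'
  exact ⟨c, hc.symm⟩

theorem exists_perm_map {α : Type*} [Finite α] (l l' : List α) (hl : l.Nodup) (hl' : l'.Nodup)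
    (h : l.length = l'.length) : ∃ σ : Equiv.Perm α, l' = l.map σ := by
  obtain ⟨σ, hσ⟩ := Equiv.Perm.exists_extending_pair (f := l.get)
    (g := fun i => l'.get (Fin.cast h i)) (List.nodup_iff_injective_get.1 hl)
    ((List.nodup_iff_injective_get.1 hl').comp (Fin.cast_injective h))
  refine ⟨σ, ?_⟩
  apply List.ext_getElem
  · simp [h]
  · intro i h1 h2
    have := hσ ⟨i, by omega⟩
    simpa using this.symm

end Helpers

/-- In the Euclidean geometric algebra `G_{n,0,0}`, every linear
`Pin(n,0,0)`-equivariant endomorphism is a linear combination of grade projections: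
`φ(x) = ∑_{k=0}^n w_k ⟨x⟩_k`. -/
theorem euclidean_equivariant_linear_maps_are_grade_projections (n : ℕ)
    (φ : GA n 0 →ₗ[ℝ] GA n 0)
    (hφ : ∀ l : List (Fin (n + 0) → ℝ), IsUnitVecList n 0 l →
      ∀ x : GA n 0, φ (pinAction n 0 l x) = pinAction n 0 l (φ x)) :
    ∃ w : Fin (n + 1) → ℝ,
      ∀ x : GA n 0, φ x = ∑ k : Fin (n + 1), w k • gradeProj n 0 (k : ℕ) x := by
  have hr : ∀ v, gaForm n 0 v = 1 → ∀ x, φ (rho n v x) = rho n v (φ x) := by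
    intro v hv x
    have := hφ [v] (by intro u hu; rw [List.mem_singleton.1 hu]; exact hv) x
    rwa [pinAction_single, pinAction_single] at this
  have hc : ∀ l : List (Fin (n + 0)), ∃ c : ℝ, l.Nodup → φ (eL n l) = c • eL n l := by
    intro l
    by_cases hl : l.Nodup
    · obtain ⟨c, hc⟩ := eigen_eq n l hl (φ (eL n l))
        (fun i hi => by rw [← hr _ (gaForm_basis n i), rho_eL_mem n i l hl hi, map_neg])
        (fun i hi => by rw [← hr _ (gaForm_basis n i), rho_eL_not_mem n i l hi])
      exact ⟨c, fun _ => hc⟩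
    · exact ⟨0, fun h => absurd h hl⟩
  choose c hc using hc
  have hσ : ∀ σ : Equiv.Perm (Fin (n + 0)), ∀ l : List (Fin (n + 0)), l.Nodup →
      c (l.map σ) = c l := by
    intro σ
    induction σ using Equiv.Perm.swap_induction_on with
    | one => intro l _; simp
    | swap_mul f i j hij ih =>
      intro l hl
      have hl1 : (l.map f).Nodup := hl.map f.injective
      have hl2 : ((l.map f).map (Equiv.swap i j)).Nodup := hl1.map (Equiv.injective _)
      have e : l.map (Equiv.swap i j * f) = (l.map f).map (Equiv.swap i j) := by
        simp [List.map_map, Equiv.Perm.coe_mul]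
      rw [e, ← ih l hl]
      have h1 := hr _ (gaForm_swapVec n hij) (eL n (l.map f))
      rw [hc _ hl1, map_smul, rho_swap_eL n hij, hc _ hl2] at h1
      exact smul_left_injective ℝ (eL_ne_zero n _) h1
  refine ⟨fun k => c ((List.finRange (n + 0)).take k), fun x => ?_⟩
  have hx := eL_span n x
  induction hx using Submodule.span_induction with
  | mem x h =>
    obtain ⟨l, hl, rfl⟩ := h
    have hlen : l.length < n + 1 := by
      have := hl.length_le_card
      simp at this
      omega
    rw [Finset.sum_eq_single (⟨l.length, hlen⟩ : Fin (n + 1))]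
    · rw [gradeProj_eL n l hl, if_pos rfl, hc l hl]
      congr 1
      have ht : ((List.finRange (n + 0)).take l.length).Nodup :=
        (List.nodup_finRange _).sublist (List.take_sublist _ _)
      obtain ⟨σ, h⟩ := exists_perm_map l ((List.finRange (n + 0)).take l.length) hl ht
        (by simp; omega)
      simp only
      rw [h, hσ σ l hl]
    · intro k _ hk
      rw [gradeProj_eL n l hl, if_neg, smul_zero]
      intro h
      exact hk (Fin.ext h.symm)
    · simp
  | zero => simp
  | add x y _ _ hx hy => simp only [map_add, smul_add, Finset.sum_add_distrib, hx, hy]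
  | smul a x _ hx =>
    rw [map_smul, hx, Finset.smul_sum]
    refine Finset.sum_congr rfl fun k _ => ?_
    rw [map_smul, smul_comm]

end
end

section
/- In the Euclidean geometric algebra G_{n,0,0}, the trilinear map EquiJoin(x, y; z) := λ (x ∨ y), defined for a pseudoscalar third argument z = λI with λ ∈ ℝ, is Pin(n,0,0)-equivariant: for every u ∈ Pin(n,0,0) and all multivectors x, y and pseudoscalars z, one has u[EquiJoin(x, y; z)] = EquiJoin(u[x], u[y]; u[z]). -/
open CliffordAlgebra

noncomputable section

/-- Euclidean dual `x* = x Ĩ` in `G_{n,0,0}`, with `I = e_1 ⋯ e_n`. -/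
def eucDual (n : ℕ) (x : GA n 0) : GA n 0 := x * reverse (eucPseudoscalar n 0)

/-- Euclidean inverse dual `x^{-*} = x I` in `G_{n,0,0}`. -/
def eucInvDual (n : ℕ) (x : GA n 0) : GA n 0 := x * eucPseudoscalar n 0

/-- Euclidean join `x ∨ y = (x* ∧ y*)^{-*}` in `G_{n,0,0}`. -/
def eucJoin (n : ℕ) (x y : GA n 0) : GA n 0 :=
  eucInvDual n (wedge n 0 (eucDual n x) (eucDual n y))

section Helpers

variable {M : Type*} [AddCommGroup M] [Module ℝ M] {Q : QuadraticForm ℝ M}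

theorem aux_map_reverse (f : Q →qᵢ Q) (x : CliffordAlgebra Q) :
    reverse (CliffordAlgebra.map f x) = CliffordAlgebra.map f (reverse x) := by
  induction x using CliffordAlgebra.induction with
  | algebraMap r => simp [AlgHom.commutes, reverse.commutes]
  | ι m => simp
  | mul a b ha hb => rw [map_mul, reverse.map_mul, ha, hb, reverse.map_mul, map_mul]
  | add a b ha hb => simp only [map_add, ha, hb]

theorem aux_map_contractLeft {Q₁ Q₂ : QuadraticForm ℝ M} (g : Q₁ →qᵢ Q₂)
    (d d' : Module.Dual ℝ M) (h : ∀ m, d (g m) = d' m) (x : CliffordAlgebra Q₁) :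
    contractLeft d (CliffordAlgebra.map g x) =
      CliffordAlgebra.map g (contractLeft d' x) := by
  induction x using CliffordAlgebra.left_induction with
  | algebraMap r => simp only [AlgHom.commutes, contractLeft_algebraMap, map_zero]
  | add x y hx hy => simp only [map_add, hx, hy]
  | ι_mul x m hx =>
    rw [map_mul, map_apply_ι, contractLeft_ι_mul, contractLeft_ι_mul, hx, h, map_sub, map_smul,
      map_mul, map_apply_ι]

theorem aux_map_changeForm {Q' : QuadraticForm ℝ M} {B : LinearMap.BilinForm ℝ M}
    (hB : B.toQuadraticMap = Q' - Q) (f : Q →qᵢ Q) (g : Q' →qᵢ Q') (hfg : ∀ m, f m = g m)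
    (hBf : ∀ a b, B (f a) (f b) = B a b) (x : CliffordAlgebra Q) :
    changeForm hB (CliffordAlgebra.map f x) = CliffordAlgebra.map g (changeForm hB x) := by
  induction x using CliffordAlgebra.left_induction with
  | algebraMap r => simp only [AlgHom.commutes, changeForm_algebraMap]
  | add x y hx hy => simp only [map_add, hx, hy]
  | ι_mul x m hx =>
    rw [map_mul, map_apply_ι, changeForm_ι_mul, changeForm_ι_mul, hx, map_sub, map_mul,
      map_apply_ι, aux_map_contractLeft g (B (f m)) (B m), hfg]
    intro a
    rw [← hfg, hBf]

/-- Reflection in the hyperplane orthogonal to a unit vector. -/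
def auxRefl (v : M) (hv : Q v = 1) : Q →qᵢ Q where
  toFun w := w - QuadraticMap.polar Q v w • v
  map_add' a b := by rw [QuadraticMap.polar_add_right, add_smul]; abel
  map_smul' c a := by
    rw [QuadraticMap.polar_smul_right, smul_sub, RingHom.id_apply, smul_assoc]
  map_app' w := by
    have h := QuadraticMap.map_add Q w (-(QuadraticMap.polar Q v w • v))
    change Q (w - QuadraticMap.polar Q v w • v) = Q w
    rw [sub_eq_add_neg, h, QuadraticMap.map_neg, QuadraticMap.map_smul, hv,
      QuadraticMap.polar_neg_right, QuadraticMap.polar_smul_right, QuadraticMap.polar_comm Q w v]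
    simp

theorem auxRefl_apply (v : M) (hv : Q v = 1) (x : CliffordAlgebra Q) :
    ι Q v * involute x * ι Q v = CliffordAlgebra.map (auxRefl v hv) x := by
  have hvv : ι Q v * ι Q v = 1 := by rw [ι_sq_scalar, hv, map_one]
  induction x using CliffordAlgebra.induction with
  | algebraMap r =>
    rw [AlgHom.commutes, AlgHom.commutes, ← Algebra.commutes, mul_assoc, hvv, mul_one]
  | ι m =>
    have h : auxRefl v hv m = m - QuadraticMap.polar Q v m • v := rfl
    rw [map_apply_ι, involute_ι, mul_neg, neg_mul, ι_mul_ι_mul_ι, hv, h]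
    simp
  | mul a b ha hb =>
    rw [map_mul, map_mul, ← ha, ← hb]
    calc ι Q v * (involute a * involute b) * ι Q v
        = ι Q v * involute a * 1 * involute b * ι Q v := by noncomm_ring
      _ = _ := by rw [← hvv]; noncomm_ring
  | add a b ha hb => simp only [map_add, mul_add, add_mul, ha, hb]

end Helpers

theorem aux_involute_iterate {n r : ℕ} (k : ℕ) (x : GA n r) :
    (⇑(involute (Q := gaForm n r)))^[k + 1] x =
      involute ((⇑(involute (Q := gaForm n r)))^[k] x) := Function.iterate_succ_apply' _ _ _

theorem aux_pinAction_eq_map (n r : ℕ) (l : List (Fin (n + r) → ℝ)) (hl : IsUnitVecList n r l) :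
    ∃ f : gaForm n r →qᵢ gaForm n r, ∀ x, pinAction n r l x = CliffordAlgebra.map f x := by
  induction l with
  | nil =>
    refine ⟨QuadraticMap.Isometry.id _, fun x => ?_⟩
    simp [pinAction, versor, map_id]
  | cons v l ih =>
    obtain ⟨f, hf⟩ := ih fun w hw => hl w (List.mem_cons_of_mem _ hw)
    have hv : gaForm n r v = 1 := hl v List.mem_cons_self
    refine ⟨(auxRefl v hv).comp f, fun x => ?_⟩
    rw [← map_comp_map, AlgHom.comp_apply, ← hf, ← auxRefl_apply]
    have h1 : involute (versor n r l) = (-1 : ℝ) ^ l.length • versor n r l :=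
      involute_prod_map_ι l
    have h2 : versor n r (v :: l) = ι (gaForm n r) v * versor n r l := by simp [versor]
    unfold pinAction
    rw [h2, reverse.map_mul, reverse_ι, List.length_cons, aux_involute_iterate, map_mul, map_mul,
      ← reverse_involute, h1, map_smul, smul_mul_assoc, smul_mul_assoc, mul_smul_comm _ (versor n r l * _),
      smul_smul, ← mul_pow]
    simp [mul_assoc]

theorem aux_map_wedge (n r : ℕ) (f : gaForm n r →qᵢ gaForm n r) (x y : GA n r) :
    CliffordAlgebra.map f (wedge n r x y) =
      wedge n r (CliffordAlgebra.map f x) (CliffordAlgebra.map f y) := by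
  have key : ∀ z, gaToExt n r (CliffordAlgebra.map f z) =
      ExteriorAlgebra.map f.toLinearMap (gaToExt n r z) := by
    intro z
    refine aux_map_changeForm changeForm.associated_neg_proof f _ (fun _ => rfl) ?_ z
    intro a b
    simp [QuadraticMap.associated_apply, ← map_add]
  apply (gaToExt n r).injective
  unfold wedge
  rw [key, LinearEquiv.apply_symm_apply, LinearEquiv.apply_symm_apply, key, key, map_mul]

theorem aux_prod_reverse (n : ℕ) (L : List (Fin (n + 0))) :
    (L.map (eVec n 0)).prod * reverse (L.map (eVec n 0)).prod = 1 := by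
  induction L with
  | nil => simp
  | cons i L ih =>
    have h : eVec n 0 i * eVec n 0 i = 1 := by
      have hi : (i : ℕ) < n := i.2
      unfold eVec
      rw [ι_sq_scalar]
      have : gaForm n 0 (gaBasisVec n 0 i) = 1 := by
        simp only [gaForm, gaBasisVec, QuadraticMap.weightedSumSquares_apply]
        rw [Finset.sum_eq_single i]
        · simp [hi]
        · intro j _ hj
          simp [hj]
        · simp
      rw [this, map_one]
    have h' : reverse (eVec n 0 i) = eVec n 0 i := reverse_ι _
    rw [List.map_cons, List.prod_cons, reverse.map_mul, h']
    calc _ = eVec n 0 i * ((L.map (eVec n 0)).prod * reverse (L.map (eVec n 0)).prod)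
          * eVec n 0 i := by noncomm_ring
      _ = 1 := by rw [ih, mul_one, h]

/-- In `G_{n,0,0}`, the map `EquiJoin(x, y; z) = λ (x ∨ y)` (for a
pseudoscalar third argument `z = λI`) is `Pin(n,0,0)`-equivariant:
`u[EquiJoin(x,y;z)] = EquiJoin(u[x], u[y]; u[z])`, where `u[z] = μ I` is again a
pseudoscalar. -/
theorem equijoin_pin_equivariant (n : ℕ)
    (l : List (Fin (n + 0) → ℝ)) (hl : IsUnitVecList n 0 l)
    (x y : GA n 0) (lam mu : ℝ)
    (hz : pinAction n 0 l (lam • eucPseudoscalar n 0) = mu • eucPseudoscalar n 0) :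
    pinAction n 0 l (lam • eucJoin n x y) =
      mu • eucJoin n (pinAction n 0 l x) (pinAction n 0 l y) := by
  obtain ⟨f, hf⟩ := aux_pinAction_eq_map n 0 l hl
  simp only [hf] at hz ⊢
  have hI : eucPseudoscalar n 0 * reverse (eucPseudoscalar n 0) = 1 := aux_prod_reverse n _
  unfold eucJoin eucInvDual eucDual
  generalize eucPseudoscalar n 0 = I at *
  have hI0 : I ≠ 0 := by
    rintro rfl
    simp at hI
  rw [map_smul] at hz ⊢
  by_cases hlam : lam = 0
  · subst hlam
    rw [zero_smul, eq_comm, smul_eq_zero] at hz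
    rcases hz with rfl | h
    · simp
    · exact absurd h hI0
  obtain ⟨s, rfl⟩ : ∃ s, mu = lam * s := ⟨mu / lam, by field_simp⟩
  rw [mul_smul] at hz
  have hs : CliffordAlgebra.map f I = s • I := smul_right_injective _ hlam hz
  have hsr : CliffordAlgebra.map f (reverse I) = s • reverse I := by
    rw [← aux_map_reverse, hs, map_smul]
  have hss : s * s = 1 := by
    have h := congrArg (CliffordAlgebra.map f) hI
    rw [map_mul, hs, hsr, smul_mul_smul_comm, hI, map_one] at h
    have h2 : (s * s - 1) • (1 : GA n 0) = 0 := by rw [sub_smul, h, one_smul, sub_self]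
    rcases smul_eq_zero.1 h2 with h3 | h3
    · linarith
    · exact absurd h3 one_ne_zero
  have hw : ∀ a b : GA n 0, wedge n 0 (s • a) (s • b) = wedge n 0 a b := by
    intro a b
    unfold wedge
    rw [map_smul, map_smul, smul_mul_smul_comm, hss, one_smul]
  rw [map_mul, aux_map_wedge, map_mul, map_mul, hs, hsr, mul_smul_comm, mul_smul_comm,
    mul_smul_comm, hw, mul_smul]

end
end
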